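/- As ν → ∞ through positive real values, √(2/π)·ν^{−(ν−1)/2}·(x/2)^{ν}·e^{ν}·e^{x²/4}·K_ν(√ν·x) → 1 uniformly for x in compact subsets of (0,∞). Equivalently, the modified Bessel function of the second kind satisfies K_ν(√ν·x) ∼ √(π/2)·ν^{(ν−1)/2}·(x/2)^{−ν}·e^{−ν}·e^{−x²/4} uniformly on compact subsets of (0,∞). -/

import Mathlib

open Filter

/-- Modified Bessel function of the second kind `K_ν(x)`. -/
noncomputable def besselK (ν x : ℝ) : ℝ :=
  ∫ t in Set.Ioi (0 : ℝ), Real.exp (-x * Real.cosh t) * Real.cosh (ν * t)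

open MeasureTheory Topology

/-- A lower bound for the Taylor remainder of `exp`, quadratic near zero and linear at infinity. -/
lemma sq_div_le_exp_sub_one_sub (w : ℝ) :
    w ^ 2 / (4 * (1 + |w|)) ≤ Real.exp w - 1 - w := by
  have hpos : 0 < 4 * (1 + |w|) := by positivity
  rw [div_le_iff₀ hpos]
  rcases le_or_gt 0 w with h | h
  · have h1 := Real.quadratic_le_exp_of_nonneg h
    rw [abs_of_nonneg h]
    nlinarith [mul_nonneg h (sq_nonneg w), sq_nonneg w, mul_nonneg h (by linarith :
      0 ≤ Real.exp w - (1 + w + w ^ 2 / 2))]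
  · rw [abs_of_neg h]
    rcases le_or_gt (-2) w with h2 | h2
    · have h3 : (1 + w / 2) ^ 2 ≤ Real.exp w := by
        have h4 : 1 + w / 2 ≤ Real.exp (w / 2) := by linarith [Real.add_one_le_exp (w / 2)]
        calc (1 + w / 2) ^ 2 ≤ Real.exp (w / 2) ^ 2 :=
              pow_le_pow_left₀ (by linarith) h4 2
          _ = Real.exp w := by rw [← Real.exp_nat_mul]; congr 1; push_cast; ring
      nlinarith [mul_nonneg (neg_nonneg.2 h.le) (sq_nonneg w), mul_nonneg (neg_nonneg.2 h.le)
        (sub_nonneg.2 h3)]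
    · nlinarith [Real.exp_pos w, mul_pos (neg_pos.2 h) (Real.exp_pos w)]

/-- The rescaled integrand of the Laplace-type representation of `K_ν(√ν·x)`,
with `a = x² / 4`. -/
noncomputable def besselKernel (ν a y : ℝ) : ℝ :=
  Real.exp (-(ν * (Real.exp (y / √ν) - 1 - y / √ν)) + a * (1 - Real.exp (-(y / √ν))))

lemma continuous_besselKernel (ν a : ℝ) : Continuous (besselKernel ν a) := by
  unfold besselKernel
  fun_prop

lemma besselKernel_nonneg (ν a y : ℝ) : 0 ≤ besselKernel ν a y :=
  (Real.exp_pos _).le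

lemma abs_sub_one_div_four_le {ν : ℝ} (hν : 1 ≤ ν) (y : ℝ) :
    (|y| - 1) / 4 ≤ ν * (Real.exp (y / √ν) - 1 - y / √ν) := by
  have hs : 1 ≤ √ν := Real.one_le_sqrt.2 hν
  have hs0 : 0 < √ν := by linarith
  have hν0 : 0 < ν := by linarith
  have habs : |y / √ν| ≤ |y| := by
    rw [abs_div, abs_of_pos hs0]
    exact div_le_self (abs_nonneg y) hs
  calc (|y| - 1) / 4 ≤ y ^ 2 / (4 * (1 + |y|)) := by
        rw [div_le_div_iff₀ (by norm_num) (by positivity), ← sq_abs y]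
        nlinarith
    _ ≤ y ^ 2 / (4 * (1 + |y / √ν|)) := by gcongr
    _ = ν * ((y / √ν) ^ 2 / (4 * (1 + |y / √ν|))) := by
        rw [div_pow, Real.sq_sqrt hν0.le]
        field_simp
    _ ≤ _ := by gcongr; exact sq_div_le_exp_sub_one_sub _

lemma besselKernel_le {ν a M : ℝ} (hν : 1 ≤ ν) (ha : 0 ≤ a) (haM : a ≤ M) (y : ℝ) :
    besselKernel ν a y ≤ Real.exp (M + 1 / 4) * Real.exp (-(1 / 4) * |y|) := by
  rw [← Real.exp_add]
  unfold besselKernel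
  have h1 := abs_sub_one_div_four_le hν y
  have h2 := mul_nonneg ha (Real.exp_pos (-(y / √ν))).le
  exact Real.exp_le_exp.2 (by linarith)

lemma integrable_exp_neg_mul_abs {c : ℝ} (hc : 0 < c) :
    Integrable (fun y : ℝ => Real.exp (-c * |y|)) := by
  rw [← integrableOn_univ, ← Set.Iic_union_Ioi (a := (0 : ℝ)), integrableOn_union]
  constructor
  · refine (integrableOn_exp_mul_Iic hc 0).congr_fun (fun y hy => ?_) measurableSet_Iic
    simp only [abs_of_nonpos (Set.mem_Iic.1 hy), neg_mul_neg]
  · refine (exp_neg_integrableOn_Ioi 0 hc).congr_fun (fun y hy => ?_) measurableSet_Ioi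
    simp only [abs_of_pos (Set.mem_Ioi.1 hy)]

lemma integrable_besselKernel {ν a : ℝ} (hν : 1 ≤ ν) (ha : 0 ≤ a) :
    Integrable (besselKernel ν a) := by
  refine ((integrable_exp_neg_mul_abs (c := 1 / 4) (by norm_num)).const_mul
    (Real.exp (a + 1 / 4))).mono' (continuous_besselKernel ν a).aestronglyMeasurable ?_
  filter_upwards with y
  rw [Real.norm_of_nonneg (besselKernel_nonneg _ _ _)]
  exact besselKernel_le hν ha le_rfl y

lemma exp_neg_mul_cosh_eq_besselKernel {ν x : ℝ} (hν : 0 < ν) (hx : 0 < x) (t : ℝ) :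
    Real.exp (-(√ν * x) * Real.cosh t + ν * t) =
      Real.exp (ν * Real.log (2 * √ν / x) - ν - x ^ 2 / 4) *
        besselKernel ν (x ^ 2 / 4) (√ν * (t - Real.log (2 * √ν / x))) := by
  have hs0 : 0 < √ν := Real.sqrt_pos.2 hν
  have hL : Real.exp (Real.log (2 * √ν / x)) = 2 * √ν / x := Real.exp_log (by positivity)
  set L := Real.log (2 * √ν / x)
  unfold besselKernel
  rw [← Real.exp_add, mul_div_cancel_left₀ _ hs0.ne', Real.cosh_eq, Real.exp_neg (t - L),
    Real.exp_sub t L, Real.exp_neg t, hL]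
  congr 1
  have ht := (Real.exp_pos t).ne'
  obtain ⟨s, hs, hsν⟩ : ∃ s, s = √ν ∧ ν = s ^ 2 := ⟨_, rfl, (Real.sq_sqrt hν.le).symm⟩
  rw [← hs] at hs0 ⊢
  rw [hsν]
  field_simp
  ring

lemma integrable_exp_neg_mul_cosh {ν x : ℝ} (hν : 1 ≤ ν) (hx : 0 < x) :
    Integrable (fun t => Real.exp (-(√ν * x) * Real.cosh t + ν * t)) := by
  have hν0 : 0 < ν := by linarith
  simp_rw [exp_neg_mul_cosh_eq_besselKernel hν0 hx]
  exact (((integrable_besselKernel hν (by positivity)).comp_mul_left'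
    (Real.sqrt_pos.2 hν0).ne').comp_sub_right _).const_mul _

lemma besselK_eq_integral_exp {ν z : ℝ}
    (h : Integrable (fun t => Real.exp (-z * Real.cosh t + ν * t))) :
    besselK ν z = 1 / 2 * ∫ t, Real.exp (-z * Real.cosh t + ν * t) := by
  have habs := integral_comp_abs (f := fun t => Real.exp (-z * Real.cosh t) * Real.cosh (ν * t))
  have heven : ∀ t : ℝ, Real.exp (-z * Real.cosh |t|) * Real.cosh (ν * |t|) =
      1 / 2 * (Real.exp (-z * Real.cosh t + ν * t) +
        Real.exp (-z * Real.cosh (-t) + ν * (-t))) := by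
    intro t
    rw [Real.cosh_abs, Real.cosh_neg, Real.exp_add, Real.exp_add]
    have : Real.cosh (ν * |t|) = Real.cosh (ν * t) := by
      rw [← Real.cosh_abs, ← Real.cosh_abs (ν * t), abs_mul, abs_mul, abs_abs]
    rw [this, Real.cosh_eq (ν * t), mul_neg]
    ring
  simp_rw [heven] at habs
  rw [integral_const_mul, integral_add h h.comp_neg,
    integral_neg_eq_self (fun t => Real.exp (-z * Real.cosh t + ν * t))] at habs
  unfold besselK
  linarith

lemma besselK_eq_integral_besselKernel {ν x : ℝ} (hν : 1 ≤ ν) (hx : 0 < x) :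
    besselK ν (√ν * x) = 1 / 2 * (Real.exp (ν * Real.log (2 * √ν / x) - ν - x ^ 2 / 4) *
      ((√ν)⁻¹ * ∫ y, besselKernel ν (x ^ 2 / 4) y)) := by
  have hν0 : 0 < ν := by linarith
  rw [besselK_eq_integral_exp (integrable_exp_neg_mul_cosh hν hx)]
  simp_rw [exp_neg_mul_cosh_eq_besselKernel hν0 hx]
  rw [integral_const_mul, integral_sub_right_eq_self
    (fun t => besselKernel ν (x ^ 2 / 4) (√ν * t)), Measure.integral_comp_mul_left,
    abs_of_pos (inv_pos.2 (Real.sqrt_pos.2 hν0)), smul_eq_mul]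

lemma normalized_besselK_eq {ν x : ℝ} (hν : 1 ≤ ν) (hx : 0 < x) :
    √(2 / Real.pi) * ν ^ (-(ν - 1) / 2) * (x / 2) ^ ν * Real.exp ν * Real.exp (x ^ 2 / 4) *
      besselK ν (√ν * x) =
        (√(2 * Real.pi))⁻¹ * ∫ y, besselKernel ν (x ^ 2 / 4) y := by
  have hν0 : 0 < ν := by linarith
  have hs0 : 0 < √ν := Real.sqrt_pos.2 hν0
  have hpi : √(2 / Real.pi) * (1 / 2) = (√(2 * Real.pi))⁻¹ := by
    rw [← Real.sqrt_inv, show (2 * Real.pi)⁻¹ = 2 / Real.pi * (1 / 2) ^ 2 by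
      field_simp, Real.sqrt_mul (by positivity), Real.sqrt_sq (by norm_num)]
  have hexp : ν ^ (-(ν - 1) / 2) * (x / 2) ^ ν * Real.exp ν * Real.exp (x ^ 2 / 4) *
      Real.exp (ν * Real.log (2 * √ν / x) - ν - x ^ 2 / 4) * (√ν)⁻¹ = 1 := by
    have hinv : (√ν)⁻¹ = Real.exp (-(Real.log ν / 2)) := by
      rw [Real.exp_neg, ← Real.log_sqrt hν0.le, Real.exp_log hs0]
    rw [hinv, Real.rpow_def_of_pos hν0, Real.rpow_def_of_pos (by positivity),
      Real.log_div (by positivity) hx.ne', Real.log_mul two_ne_zero hs0.ne',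
      Real.log_sqrt hν0.le, Real.log_div hx.ne' two_ne_zero]
    simp only [← Real.exp_add]
    rw [Real.exp_eq_one_iff]
    ring
  rw [besselK_eq_integral_besselKernel hν hx, ← hpi]
  linear_combination (√(2 / Real.pi) * (1 / 2) * ∫ y, besselKernel ν (x ^ 2 / 4) y) * hexp

lemma tendsto_exp_sub_one_sub_div_sq :
    Tendsto (fun w : ℝ => (Real.exp w - 1 - w) / w ^ 2) (𝓝[≠] 0) (𝓝 (1 / 2)) := by
  have h := ((Real.exp_sub_sum_range_succ_isLittleO_pow 2).mono
    (nhdsWithin_le_nhds (s := {0}ᶜ))).tendsto_div_nhds_zero.add_const (1 / 2)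
  rw [zero_add] at h
  refine h.congr' ?_
  filter_upwards [self_mem_nhdsWithin] with w hw
  have hw0 : w ≠ 0 := hw
  simp only [Finset.sum_range_succ, Finset.sum_range_zero, Nat.factorial]
  push_cast
  field_simp
  ring

lemma tendsto_mul_exp_div_sqrt_sub (y : ℝ) :
    Tendsto (fun ν : ℝ => ν * (Real.exp (y / √ν) - 1 - y / √ν)) atTop (𝓝 (y ^ 2 / 2)) := by
  rcases eq_or_ne y 0 with rfl | hy
  · simp
  have hw : Tendsto (fun ν : ℝ => y / √ν) atTop (𝓝[≠] 0) := by
    refine tendsto_nhdsWithin_iff.2 ⟨tendsto_const_nhds.div_atTop Real.tendsto_sqrt_atTop, ?_⟩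
    filter_upwards [eventually_gt_atTop 0] with ν hν
    exact div_ne_zero hy (Real.sqrt_pos.2 hν).ne'
  have h := (tendsto_exp_sub_one_sub_div_sq.comp hw).const_mul (y ^ 2)
  rw [mul_one_div] at h
  refine h.congr' ?_
  filter_upwards [eventually_gt_atTop 0] with ν hν
  have hs : √ν ≠ 0 := (Real.sqrt_pos.2 hν).ne'
  simp only [Function.comp_apply]
  rw [div_pow, Real.sq_sqrt hν.le]
  field_simp

lemma tendsto_integral_besselKernel {ι : Type*} {l : Filter ι} [l.IsCountablyGenerated]
    {ν a : ι → ℝ} {M : ℝ} (hν : Tendsto ν l atTop) (ha : ∀ᶠ i in l, 0 ≤ a i)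
    (haM : ∀ᶠ i in l, a i ≤ M) :
    Tendsto (fun i => ∫ y, besselKernel (ν i) (a i) y) l (𝓝 √(2 * Real.pi)) := by
  have hgauss : ∫ y : ℝ, Real.exp (-(1 / 2) * y ^ 2) = √(2 * Real.pi) := by
    rw [integral_gaussian]
    congr 1
    ring
  rw [← hgauss]
  refine tendsto_integral_filter_of_dominated_convergence
    (fun y => Real.exp (M + 1 / 4) * Real.exp (-(1 / 4) * |y|))
    (Eventually.of_forall fun i => (continuous_besselKernel _ _).aestronglyMeasurable) ?_
    ((integrable_exp_neg_mul_abs (by norm_num)).const_mul _) ?_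
  · filter_upwards [hν.eventually_ge_atTop 1, ha, haM] with i h1 h2 h3
    filter_upwards with y
    rw [Real.norm_of_nonneg (besselKernel_nonneg _ _ _)]
    exact besselKernel_le h1 h2 h3 y
  · filter_upwards with y
    have hmain := (tendsto_mul_exp_div_sqrt_sub y).comp hν
    have hsmall : Tendsto (fun i => a i * (1 - Real.exp (-(y / √(ν i))))) l (𝓝 0) := by
      have hw : Tendsto (fun i => y / √(ν i)) l (𝓝 0) :=
        tendsto_const_nhds.div_atTop (Real.tendsto_sqrt_atTop.comp hν)
      have h0 : Tendsto (fun i => 1 - Real.exp (-(y / √(ν i)))) l (𝓝 0) := by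
        simpa using ((Real.continuous_exp.tendsto _).comp hw.neg).const_sub 1
      refine bdd_le_mul_tendsto_zero' M ?_ h0
      filter_upwards [ha, haM] with i h2 h3
      rwa [abs_of_nonneg h2]
    have h := (Real.continuous_exp.tendsto _).comp (hmain.neg.add hsmall)
    rwa [show -(y ^ 2 / 2) + 0 = -(1 / 2) * y ^ 2 by ring] at h

/-- Asymptotics of the modified Bessel function of the second kind:
`K_ν(√ν·x) ∼ √(π/2)·ν^{(ν−1)/2}·(x/2)^{−ν}·e^{−ν}·e^{−x²/4}` uniformly on compact subsets of
`(0,∞)` as `ν → ∞` through positive real values. -/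
theorem besselK_asymptotics (Ω : Set ℝ) (hΩ : IsCompact Ω) (hΩ' : Ω ⊆ Set.Ioi (0 : ℝ)) :
    TendstoUniformlyOn
      (fun (ν : ℝ) (x : ℝ) =>
        Real.sqrt (2 / Real.pi) * ν ^ (-(ν - 1) / 2) * (x / 2) ^ ν * Real.exp ν *
          Real.exp (x ^ 2 / 4) * besselK ν (Real.sqrt ν * x))
      (fun _ => 1) atTop Ω := by
  obtain ⟨B, hB⟩ := hΩ.bddAbove
  have hmem : ∀ᶠ q : ℝ × ℝ in atTop ×ˢ 𝓟 Ω, q.2 ∈ Ω :=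
    tendsto_snd.eventually (mem_principal_self Ω)
  have hint := tendsto_integral_besselKernel (l := (atTop : Filter ℝ) ×ˢ 𝓟 Ω) (M := B ^ 2 / 4)
    (ν := Prod.fst) (a := fun q => q.2 ^ 2 / 4) tendsto_fst
    (Eventually.of_forall fun q => by positivity) (by
      filter_upwards [hmem] with q hq
      have h0 : 0 < q.2 := hΩ' hq
      have h1 : q.2 ≤ B := hB hq
      gcongr)
  have hlim := hint.const_mul (√(2 * Real.pi))⁻¹
  rw [inv_mul_cancel₀ (by positivity)] at hlim
  rw [tendstoUniformlyOn_iff_tendsto]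
  refine (Uniform.tendsto_nhds_right.1 hlim).congr' ?_
  filter_upwards [hmem, tendsto_fst.eventually (eventually_ge_atTop 1)] with q hq h1
  rw [normalized_besselK_eq h1 (hΩ' hq)]
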